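/- Under the logistic missingness model and the location-scale outcome model with M₁(γ) < ∞, the normalization identity E[exp(α₁ + β·X₁ + γ·μ(X)) | R = 1] · M₁(γ) = 1 holds. -/

import Mathlib

open MeasureTheory ProbabilityTheory

/-- Under the logistic missingness model and the location-scale outcome model with
`M₁(γ) < ∞`, the normalization identity
`E[exp(α₁ + β·X₁ + γ·μ(X)) | R = 1] · M₁(γ) = 1` holds. -/
theorem normalization_identity
    {Ω : Type*} [MeasurableSpace Ω] (P : Measure Ω) [IsProbabilityMeasure P]
    {d d₁ : ℕ}
    (X : Ω → (Fin d → ℝ)) (Y : Ω → ℝ) (R : Ω → ℝ)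
    (hX : Measurable X) (hY : Measurable Y) (hR : Measurable R)
    (hR01 : ∀ ω, R ω = 0 ∨ R ω = 1)
    (proj : (Fin d → ℝ) →ₗ[ℝ] (Fin d₁ → ℝ))
    (α₀ : ℝ) (β : Fin d₁ → ℝ) (γ : ℝ)
    (hmodel : (fun ω => (1 + Real.exp (α₀ + ∑ i, β i * proj (X ω) i + γ * Y ω))⁻¹)
      =ᵐ[P] P[R | MeasurableSpace.comap (fun ω => (X ω, Y ω)) inferInstance])
    (η : ℝ) (hη : η = (P {ω | R ω = 1}).toReal) (hη0 : 0 < η) (hη1 : η < 1)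
    (α₁ : ℝ) (hα₁ : α₁ = α₀ + Real.log (η / (1 - η)))
    -- location-scale outcome model
    (μreg : (Fin d → ℝ) → ℝ) (hμ : Measurable μreg)
    (hindep : IndepFun (fun ω => Y ω - μreg (X ω)) X (P[|{ω | R ω = 1}]))
    (hεint : Integrable (fun ω => Y ω - μreg (X ω)) (P[|{ω | R ω = 1}]))
    (hεmean : ∫ ω, (Y ω - μreg (X ω)) ∂(P[|{ω | R ω = 1}]) = 0)
    (hM1 : Integrable (fun ω => Real.exp (γ * (Y ω - μreg (X ω)))) (P[|{ω | R ω = 1}]))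
    (M₁γ : ℝ)
    (hM₁γ : M₁γ = ∫ ω, Real.exp (γ * (Y ω - μreg (X ω))) ∂(P[|{ω | R ω = 1}])) :
    (∫ ω, Real.exp (α₁ + ∑ i, β i * proj (X ω) i + γ * μreg (X ω)) ∂(P[|{ω | R ω = 1}]))
      * M₁γ = 1 := by
  set S : Set Ω := {ω | R ω = 1} with hS
  have hSm : MeasurableSet S := hR (measurableSet_singleton 1)
  have hprojm : Measurable (fun x : Fin d → ℝ => ∑ i, β i * proj x i) := by
    have hc : Continuous proj := proj.continuous_of_finiteDimensional
    fun_prop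
  set Z : Ω → (Fin d → ℝ) × ℝ := fun ω => (X ω, Y ω) with hZ
  have hZm : Measurable Z := hX.prodMk hY
  have hm := hZm.comap_le
  set g : (Fin d → ℝ) × ℝ → ℝ := fun z => Real.exp (α₀ + ∑ i, β i * proj z.1 i + γ * z.2) with hg
  have hgm : Measurable g := by
    have h1 : Measurable (fun z : (Fin d → ℝ) × ℝ => ∑ i, β i * proj z.1 i) :=
      hprojm.comp measurable_fst
    exact ((h1.const_add α₀).add (measurable_snd.const_mul γ)).exp
  have hgpos : ∀ z, 0 < g z := fun z => Real.exp_pos _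
  set p : Ω → ℝ := fun ω => (1 + g (Z ω))⁻¹ with hp
  have hpm : Measurable p := ((hgm.comp hZm).const_add 1).inv
  have hp0 : ∀ ω, 0 ≤ p ω := fun ω => by
    have := hgpos (Z ω)
    simp only [hp]; positivity
  have hp1 : ∀ ω, p ω ≤ 1 := fun ω => by
    have := hgpos (Z ω)
    exact inv_le_one_of_one_le₀ (by linarith)
  have hpint : Integrable p P := by
    refine Integrable.of_bound hpm.aestronglyMeasurable 1 (ae_of_all _ fun ω => ?_)
    rw [Real.norm_eq_abs, abs_of_nonneg (hp0 ω)]; exact hp1 ω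
  have hRind : R = S.indicator (fun _ => (1 : ℝ)) := by
    funext ω
    rcases hR01 ω with h | h <;> simp [hS, Set.indicator, h]
  have hRint : Integrable R P := by
    rw [hRind]; exact (integrable_const _).indicator hSm
  have hpset : ∀ B, MeasurableSet B → ∫ ω in Z ⁻¹' B, p ω ∂P = (P (Z ⁻¹' B ∩ S)).toReal := by
    intro B hB
    have h1 : ∫ ω in Z ⁻¹' B, p ω ∂P = ∫ ω in Z ⁻¹' B, R ω ∂P := by
      rw [← setIntegral_condExp hm hRint ⟨B, hB, rfl⟩]
      exact integral_congr_ae (ae_restrict_of_ae hmodel)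
    rw [h1, hRind, setIntegral_indicator hSm]
    simp [Measure.real]
  have hmap : (P.restrict S).map Z = (P.withDensity (fun ω => ENNReal.ofReal (p ω))).map Z := by
    ext B hB
    rw [Measure.map_apply hZm hB, Measure.map_apply hZm hB, Measure.restrict_apply (hZm hB),
      withDensity_apply _ (hZm hB),
      ← ofReal_integral_eq_lintegral_ofReal hpint.integrableOn (ae_of_all _ hp0), hpset B hB,
      ENNReal.ofReal_toReal (measure_ne_top _ _)]
  have hpη : ∫ ω, p ω ∂P = η := by
    have := hpset Set.univ MeasurableSet.univ
    simpa [hη] using this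
  have hlin : ∫⁻ ω in S, ENNReal.ofReal (g (Z ω)) ∂P = ENNReal.ofReal (1 - η) := by
    have hgm' : Measurable (fun z => ENNReal.ofReal (g z)) := hgm.ennreal_ofReal
    have hgZ : Measurable (fun ω => ENNReal.ofReal (g (Z ω))) := hgm'.comp hZm
    rw [← lintegral_map hgm' hZm, hmap, lintegral_map hgm' hZm,
      lintegral_withDensity_eq_lintegral_mul _ hpm.ennreal_ofReal hgZ, ← hpη]
    have : 1 - ∫ ω, p ω ∂P = ∫ ω, (1 - p ω) ∂P := by
      rw [integral_sub (integrable_const _) hpint]; simp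
    have hqint : Integrable (fun ω => 1 - p ω) P := (integrable_const _).sub hpint
    rw [this, ofReal_integral_eq_lintegral_ofReal hqint
      (ae_of_all _ fun ω => sub_nonneg.2 (hp1 ω))]
    refine lintegral_congr fun ω => ?_
    simp only [Pi.mul_apply]
    rw [← ENNReal.ofReal_mul (hp0 ω)]
    congr 1
    have := hgpos (Z ω)
    simp only [hp]
    field_simp
    ring
  have hint : ∫ ω in S, g (Z ω) ∂P = 1 - η := by
    rw [integral_eq_lintegral_of_nonneg_ae (ae_of_all _ fun ω => (hgpos _).le)
      (hgm.comp hZm).aestronglyMeasurable, hlin, ENNReal.toReal_ofReal (by linarith)]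
  have hind : IndepFun (fun ω => Real.exp (α₁ + ∑ i, β i * proj (X ω) i + γ * μreg (X ω)))
      (fun ω => Real.exp (γ * (Y ω - μreg (X ω)))) (P[|S]) :=
    hindep.symm.comp (φ := fun x => Real.exp (α₁ + ∑ i, β i * proj x i + γ * μreg x))
      (ψ := fun e => Real.exp (γ * e))
      ((hprojm.const_add α₁).add (hμ.const_mul γ)).exp (measurable_id.const_mul γ).exp
  have hA : Measurable (fun ω => Real.exp (α₁ + ∑ i, β i * proj (X ω) i + γ * μreg (X ω))) :=
    (((hprojm.const_add α₁).add (hμ.const_mul γ)).exp).comp hX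
  rw [hM₁γ, ← hind.integral_fun_mul_eq_mul_integral hA.aestronglyMeasurable
    hM1.aestronglyMeasurable]
  have hη1' : 0 < 1 - η := by linarith
  have heq : ∀ ω, Real.exp (α₁ + ∑ i, β i * proj (X ω) i + γ * μreg (X ω)) *
      Real.exp (γ * (Y ω - μreg (X ω))) = η / (1 - η) * g (Z ω) := by
    intro ω
    rw [← Real.exp_log (div_pos hη0 hη1'), ← Real.exp_add, ← Real.exp_add, hα₁]
    congr 1
    simp only [hZ]
    ring
  simp_rw [heq]
  rw [integral_const_mul, ProbabilityTheory.cond, integral_smul_measure, hint,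
    ENNReal.toReal_inv, ← hη, smul_eq_mul]
  field_simp
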